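/- arXiv:1503.06924 — 2 statements merged into one kernel-verified Lean document; each statement's English description precedes it below -/
import Mathlib

section
/- For every integer l ≥ 3, the graph G(l) satisfies λ(G(l)) ≤ 6; that is, G(l) admits a 6-L(2,1)-labeling. -/
/-- An L(2,1)-labeling of a simple graph: adjacent vertices get labels differing by
at least 2, and vertices at distance exactly 2 get distinct labels. -/
def IsL21Labeling {V : Type*} (G : SimpleGraph V) (f : V → ℕ) : Prop :=
  (∀ a b : V, G.Adj a b → 2 ≤ ((f a : ℤ) - (f b : ℤ)).natAbs) ∧
  (∀ a b : V, G.dist a b = 2 → f a ≠ f b)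

/-- A k-L(2,1)-labeling: an L(2,1)-labeling with all labels in {0, 1, ..., k}. -/
def IsKL21Labeling {V : Type*} (G : SimpleGraph V) (k : ℕ) (f : V → ℕ) : Prop :=
  IsL21Labeling G f ∧ ∀ a : V, f a ≤ k

/-- The λ-number of a graph: the least k such that G admits a k-L(2,1)-labeling. -/
noncomputable def lambdaNumber {V : Type*} (G : SimpleGraph V) : ℕ :=
  sInf {k : ℕ | ∃ f : V → ℕ, IsKL21Labeling G k f}

/-- The vertices of the graph G(l): u, v, x_1, ..., x_l, y_1, ..., y_l.
Here `x i` for `i : Fin l` stands for the paper's x_{i+1} (0-indexed). -/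
inductive GLVert (l : ℕ) : Type where
  | u : GLVert l
  | v : GLVert l
  | x : Fin l → GLVert l
  | y : Fin l → GLVert l

/-- The edge relation of G(l) (up to symmetrization):
x_i x_{i+1}, y_i y_{i+1}, x_i y_i, u x_1, u y_1, v x_l, v y_l. -/
def GLRel (l : ℕ) : GLVert l → GLVert l → Prop
  | .x i, .x j => (i : ℕ) + 1 = (j : ℕ)
  | .y i, .y j => (i : ℕ) + 1 = (j : ℕ)
  | .x i, .y j => i = j
  | .u, .x i => (i : ℕ) = 0
  | .u, .y i => (i : ℕ) = 0
  | .x i, .v => (i : ℕ) = l - 1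
  | .y i, .v => (i : ℕ) = l - 1
  | _, _ => False

/-- The graph G(l) from the paper. -/
def GLGraph (l : ℕ) : SimpleGraph (GLVert l) := SimpleGraph.fromRel (GLRel l)

/-- The labeling of G(l): the ladder carries the 3-periodic columns (0, 3), (2, 5), (4, 1), started
at position `s`, and both end vertices are labeled 6. -/
def ladderLabel (l s : ℕ) : GLVert l → ℕ
  | .u => 6
  | .v => 6
  | .x i => 2 * ((i + s) % 3)
  | .y i => (2 * ((i + s) % 3) + 3) % 6

theorem ladderLabel_le (l s : ℕ) (a : GLVert l) : ladderLabel l s a ≤ 6 := by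
  cases a <;> simp only [ladderLabel] <;> omega

theorem ladderLabel_adj {l s : ℕ} (hs : s % 3 ≠ 1) (hl : (l - 1 + s) % 3 ≠ 1) {a b : GLVert l}
    (h : (GLGraph l).Adj a b) : 2 ≤ ((ladderLabel l s a : ℤ) - ladderLabel l s b).natAbs := by
  rw [GLGraph, SimpleGraph.fromRel_adj] at h
  cases a <;> cases b <;>
    simp only [GLRel, Fin.ext_iff, ladderLabel, or_false, false_or, and_false] at h ⊢ <;> omega

theorem ladderLabel_ne_of_common_neighbor {l s : ℕ} (hl : 2 ≤ l) {a b c : GLVert l}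
    (hab : a ≠ b) (hac : (GLGraph l).Adj a c) (hcb : (GLGraph l).Adj c b) :
    ladderLabel l s a ≠ ladderLabel l s b := by
  rw [GLGraph, SimpleGraph.fromRel_adj] at hac hcb
  cases a <;> cases b <;> cases c <;>
    simp only [GLRel, Fin.ext_iff, ladderLabel, or_false, false_or, and_false, ne_eq,
      GLVert.x.injEq, GLVert.y.injEq, not_true_eq_false] at hab hac hcb ⊢ <;> omega

theorem exists_common_neighbor_of_dist_eq_two {V : Type*} {G : SimpleGraph V} {a b : V}
    (h : G.dist a b = 2) : a ≠ b ∧ ∃ c, G.Adj a c ∧ G.Adj c b := by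
  refine ⟨by rintro rfl; simp at h, ?_⟩
  have hr : G.Reachable a b := by
    by_contra hr
    simp [SimpleGraph.dist_eq_zero_of_not_reachable hr] at h
  obtain ⟨p, hp⟩ := hr.exists_walk_length_eq_dist
  rw [h] at hp
  match p, hp with
  | .cons hac (.cons hcb .nil), _ => exact ⟨_, hac, hcb⟩

theorem isKL21Labeling_ladderLabel {l s : ℕ} (hl : 2 ≤ l) (hs : s % 3 ≠ 1)
    (hls : (l - 1 + s) % 3 ≠ 1) : IsKL21Labeling (GLGraph l) 6 (ladderLabel l s) := by
  refine ⟨⟨fun a b h => ladderLabel_adj hs hls h, fun a b h => ?_⟩, ladderLabel_le l s⟩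
  obtain ⟨hab, c, hac, hcb⟩ := exists_common_neighbor_of_dist_eq_two h
  exact ladderLabel_ne_of_common_neighbor hl hab hac hcb

theorem stmt1 (l : ℕ) (hl : 3 ≤ l) :
    lambdaNumber (GLGraph l) ≤ 6 ∧
    ∃ f : GLVert l → ℕ, IsKL21Labeling (GLGraph l) 6 f := by
  have h : ∃ f : GLVert l → ℕ, IsKL21Labeling (GLGraph l) 6 f := by
    by_cases hl2 : l % 3 = 2
    · exact ⟨_, isKL21Labeling_ladderLabel (s := 2) (by omega) (by omega) (by omega)⟩
    · exact ⟨_, isKL21Labeling_ladderLabel (s := 0) (by omega) (by omega) (by omega)⟩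
  exact ⟨Nat.sInf_le h, h⟩
end

section
/- Let l ≥ 4, let H be the graph obtained from the cycle C = u_1 u_2 ... u_l u_1 by adding two new vertices v_1, v_2 and the edges u_1 v_1 and u_2 v_2, and let P be the path v_1 u_1 u_2 v_2 in H. Let f be a path-extendable 6-L(2,1)-labeling of P with {f(u_1), f(u_2)} ∩ {1, 3, 5} ≠ ∅. Suppose f can be extended to a 6-L(2,1)-labeling g of the subgraph of H induced by {v_1, v_2, u_1, u_2, u_3, u_l} such that g(u_3), g(u_l) ∈ {0, 2, 4, 6}, and suppose further that g(u_3) = g(u_l) if and only if l ≡ 0 (mod 3). Then f can be extended to a 6-L(2,1)-labeling f_1 of H such that the restriction of f_1 to the path C − u_1u_2 is a path-extendable 6-L(2,1)-labeling of that path. -/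
/-- The path graph on `Fin n`, with edges between consecutive indices. -/
def PathGraph (n : ℕ) : SimpleGraph (Fin n) :=
  SimpleGraph.fromRel (fun p q => (p : ℕ) + 1 = (q : ℕ))

/-- The vertex type of members of 𝓗(P) for P = u u_1 ... u_l v :
`Sum.inl 0` is u, `Sum.inl i` is u_i for 1 ≤ i ≤ l, `Sum.inl (l+1)` is v,
and `Sum.inr (i, false)`, `Sum.inr (i, true)` are the (at most two) new internal
vertices of a path attached at the pair (u_i, u_{i+1}). -/
abbrev PVert (l : ℕ) := Fin (l + 2) ⊕ (ℕ × Bool)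

/-- An attachment specification `D` : at position `i`, `none` means no attached path,
`some false` means a path of length 2 (one new vertex), `some true` means a path of
length 3 (two new vertices). Valid specs attach only at pairs (u_i, u_{i+1}) with
1 ≤ i ≤ l-1, and no two attachment positions are consecutive (i.e. gaps ≥ 2). -/
def ValidD (l : ℕ) (D : ℕ → Option Bool) : Prop :=
  (∀ i, (D i).isSome → 1 ≤ i ∧ i + 1 ≤ l) ∧
  (∀ i, ¬ ((D i).isSome ∧ (D (i + 1)).isSome))

/-- The edge relation (up to symmetrization) of the member of 𝓗(P) described by `D`. -/
def attachRel (l : ℕ) (D : ℕ → Option Bool) : PVert l → PVert l → Prop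
  | Sum.inl p, Sum.inl q => (p : ℕ) + 1 = (q : ℕ)
  | Sum.inl p, Sum.inr (i, k) =>
      ((p : ℕ) = i ∧ k = false) ∨
      ((p : ℕ) = i + 1 ∧ ((D i = some false ∧ k = false) ∨ (D i = some true ∧ k = true)))
  | Sum.inr (i, k), Sum.inr (j, m) => i = j ∧ D i = some true ∧ k = false ∧ m = true
  | _, _ => False

def AttachG (l : ℕ) (D : ℕ → Option Bool) : SimpleGraph (PVert l) :=
  SimpleGraph.fromRel (attachRel l D)

/-- The vertices actually present in the member of 𝓗(P) described by `D`. -/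
def Active {l : ℕ} (D : ℕ → Option Bool) : PVert l → Prop
  | Sum.inl _ => True
  | Sum.inr (i, k) => (D i).isSome ∧ (k = false ∨ D i = some true)

/-- `f` extends to a 6-L(2,1)-labeling of the member of 𝓗(P) described by `D`. -/
def ExtendsToAttach (l : ℕ) (D : ℕ → Option Bool) (f : Fin (l + 2) → ℕ) : Prop :=
  ∃ g : ↥{w : PVert l | Active D w} → ℕ,
    IsKL21Labeling ((AttachG l D).induce {w : PVert l | Active D w}) 6 g ∧
    ∀ p : Fin (l + 2), g ⟨Sum.inl p, trivial⟩ = f p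

/-- A path-extendable 6-L(2,1)-labeling of the path P = u u_1 ... u_l v :
a 6-L(2,1)-labeling of P that extends to a 6-L(2,1)-labeling of every H ∈ 𝓗(P). -/
def PathExtendable (l : ℕ) (f : Fin (l + 2) → ℕ) : Prop :=
  IsKL21Labeling (PathGraph (l + 2)) 6 f ∧
  ∀ D : ℕ → Option Bool, ValidD l D → ExtendsToAttach l D f

/-- The graph H : the cycle u_1 ... u_l (vertex `Sum.inl j` is u_{j+1}) together with
two pendant vertices v_1 = `Sum.inr false` adjacent to u_1 and v_2 = `Sum.inr true`
adjacent to u_2. -/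
def hcycRel (l : ℕ) : (Fin l ⊕ Bool) → (Fin l ⊕ Bool) → Prop
  | Sum.inl p, Sum.inl q => ((p : ℕ) + 1) % l = (q : ℕ)
  | Sum.inr false, Sum.inl p => (p : ℕ) = 0
  | Sum.inr true, Sum.inl p => (p : ℕ) = 1
  | _, _ => False

def HCyc (l : ℕ) : SimpleGraph (Fin l ⊕ Bool) := SimpleGraph.fromRel (hcycRel l)

/-- The six vertices v_1, v_2, u_1, u_2, u_3, u_l of H. -/
def S6 (l : ℕ) : Set (Fin l ⊕ Bool) :=
  {w | w = Sum.inr false ∨ w = Sum.inr true ∨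
    ∃ j : Fin l, w = Sum.inl j ∧
      ((j : ℕ) = 0 ∨ (j : ℕ) = 1 ∨ (j : ℕ) = 2 ∨ (j : ℕ) = l - 1)}

theorem memS6inl (l : ℕ) (j : Fin l)
    (h : (j : ℕ) = 0 ∨ (j : ℕ) = 1 ∨ (j : ℕ) = 2 ∨ (j : ℕ) = l - 1) :
    Sum.inl j ∈ S6 l :=
  Or.inr (Or.inr ⟨j, rfl, h⟩)

/-- Two labels differ by at least 2. -/
def LabelSep (a b : ℕ) : Prop := a + 2 ≤ b ∨ b + 2 ≤ a

instance (a b : ℕ) : Decidable (LabelSep a b) := inferInstanceAs (Decidable (_ ∨ _))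

/-- Four consecutive labels of a path admit a labeling of a path of length 2, respectively 3,
attached at the two middle vertices. -/
def Window (a b c d : ℕ) : Prop :=
  (∃ x < 7, LabelSep x b ∧ LabelSep x c ∧ x ≠ a ∧ x ≠ d) ∧
  (∃ x < 7, LabelSep x b ∧ x ≠ a ∧ x ≠ c ∧ ∃ y < 7, LabelSep y c ∧ LabelSep x y ∧ y ≠ b ∧ y ≠ d)

instance (a b c d : ℕ) : Decidable (Window a b c d) := inferInstanceAs (Decidable (_ ∧ _))

/-- The local conditions on the sequence of labels of a path-extendable labeling. -/
def PathOk : List ℕ → Prop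
  | a :: b :: c :: d :: t => LabelSep a b ∧ a ≠ c ∧ Window a b c d ∧ PathOk (b :: c :: d :: t)
  | [a, b, c] => LabelSep a b ∧ a ≠ c ∧ LabelSep b c
  | _ => True

instance decidablePathOk : (L : List ℕ) → Decidable (PathOk L)
  | a :: b :: c :: d :: t =>
    haveI := decidablePathOk (b :: c :: d :: t)
    inferInstanceAs (Decidable (LabelSep a b ∧ a ≠ c ∧ Window a b c d ∧ PathOk (b :: c :: d :: t)))
  | [a, b, c] => inferInstanceAs (Decidable (LabelSep a b ∧ a ≠ c ∧ LabelSep b c))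
  | [] => inferInstanceAs (Decidable True)
  | [_] => inferInstanceAs (Decidable True)
  | [_, _] => inferInstanceAs (Decidable True)

/-- The list `s` is an admissible choice of the labels of `u_3, ..., u_l`, where `a, b, c, d` are
the labels of `v_1, u_1, u_2, v_2`. -/
def Fits (a b c d : ℕ) (s : List ℕ) : Prop :=
  (∀ x ∈ s, x ≤ 6) ∧ s.headD b ≠ b ∧ s.headD d ≠ d ∧ s.getLastD a ≠ a ∧ s.getLastD c ≠ c ∧
    PathOk (c :: (s ++ [b]))

instance (a b c d : ℕ) (s : List ℕ) : Decidable (Fits a b c d s) :=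
  inferInstanceAs (Decidable (_ ∧ _))

/-- The first three labels of `s` can be repeated any number of times. -/
def Repeats : List ℕ → Prop
  | p :: q :: r :: _ => LabelSep p q ∧ LabelSep q r ∧ LabelSep r p ∧
      Window p q r p ∧ Window q r p q ∧ Window r p q r
  | _ => False

instance : (s : List ℕ) → Decidable (Repeats s)
  | _ :: _ :: _ :: _ => inferInstanceAs (Decidable (_ ∧ _))
  | [] => inferInstanceAs (Decidable False)
  | [_] => inferInstanceAs (Decidable False)
  | [_, _] => inferInstanceAs (Decidable False)

/-- The labels `a, b, c, d` form a labeling of the path `v_1 u_1 u_2 v_2` with an odd label in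
the middle. -/
def Core (a b c d : ℕ) : Prop :=
  LabelSep b c ∧ (b % 2 = 1 ∨ c % 2 = 1) ∧ LabelSep a b ∧ LabelSep c d ∧ a ≠ c ∧ b ≠ d

instance (a b c d : ℕ) : Decidable (Core a b c d) := inferInstanceAs (Decidable (_ ∧ _))

/-- The labels `x, y` are possible for the neighbours `u_3, u_l` of the middle vertices. -/
def Ends (a b c d x y : ℕ) : Prop :=
  LabelSep x c ∧ x ≠ b ∧ x ≠ d ∧ LabelSep y b ∧ y ≠ c ∧ y ≠ a

instance (a b c d x y : ℕ) : Decidable (Ends a b c d x y) := inferInstanceAs (Decidable (_ ∧ _))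

theorem Fits.insert_period {a b c d : ℕ} {s : List ℕ} (h : Fits a b c d s) (hr : Repeats s) :
    ∃ s', s'.length = s.length + 3 ∧ Fits a b c d s' ∧ Repeats s' := by
  match s, hr with
  | p :: q :: r :: t, hr =>
    obtain ⟨h6, h1, h2, h3, h4, h5⟩ := h
    refine ⟨p :: q :: r :: p :: q :: r :: t, by simp, ⟨?_, h1, h2, ?_, ?_, ?_⟩, hr⟩
    · intro x hx
      apply h6
      simp only [List.mem_cons] at hx ⊢
      tauto
    · simpa [List.getLastD_eq_getLast?, List.getLast?_cons] using h3
    · simpa [List.getLastD_eq_getLast?, List.getLast?_cons] using h4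
    · have hs : ∀ x y, LabelSep x y → y ≠ x := by unfold LabelSep; intros; omega
      obtain ⟨k1, k2, k3, k4, k5, k6⟩ := hr
      rw [List.cons_append, List.cons_append, List.cons_append] at h5
      obtain ⟨m1, m2, m3, m4⟩ := h5
      exact ⟨m1, m2, m3, k1, (hs _ _ k3), k4, k2, hs _ _ k1, k5, k3, hs _ _ k2, k6, m4⟩

theorem fits_two : ∀ a b c d : Fin 7, Core a b c d →
    (∃ x y : Fin 4, x ≠ y ∧ Ends a b c d (2 * x) (2 * y)) →
    ∃ s ∈ ([[0, 4], [4, 0], [2, 6], [6, 2], [0, 6], [6, 0], [2, 4], [4, 2], [6, 4], [0, 2],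
      [4, 6], [2, 0]] : List (List ℕ)),
      Fits a b c d s := by
  decide +kernel

theorem fits_three : ∀ a b c d : Fin 7, Core a b c d →
    (∃ x y : Fin 4, x ≠ y ∧ Ends a b c d (2 * x) (2 * y)) →
    ∃ s ∈ ([[0, 2, 6], [6, 2, 0], [3, 0, 4], [3, 6, 2], [5, 2, 4], [1, 4, 2], [4, 2, 5],
      [2, 4, 1], [4, 0, 3], [2, 6, 3], [1, 4, 0], [0, 4, 1], [5, 2, 6], [6, 2, 5],
      [0, 4, 6], [6, 4, 0], [0, 5, 1], [6, 1, 5], [1, 5, 0], [5, 1, 6]] : List (List ℕ)),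
      Fits a b c d s := by
  decide +kernel

theorem fits_four : ∀ a b c d : Fin 7, Core a b c d →
    (∃ x : Fin 4, Ends a b c d (2 * x) (2 * x)) →
    ∃ s ∈ ([[0, 2, 4, 0], [6, 0, 2, 6], [0, 4, 2, 0], [6, 2, 0, 6], [2, 0, 6, 4], [4, 6, 0, 2],
      [0, 3, 6, 4], [2, 0, 4, 2], [2, 4, 0, 2], [4, 2, 0, 3]] : List (List ℕ)),
      Fits a b c d s ∧ Repeats s := by
  decide +kernel

theorem fits_five : ∀ a b c d : Fin 7, Core a b c d →
    (∃ x y : Fin 4, x ≠ y ∧ Ends a b c d (2 * x) (2 * y)) →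
    ∃ s ∈ ([[0, 2, 6, 0, 4], [4, 0, 6, 2, 0], [2, 4, 0, 2, 6], [6, 2, 0, 4, 2], [0, 6, 2, 0, 6],
      [6, 0, 2, 6, 0], [0, 2, 6, 3, 0], [6, 0, 3, 6, 4], [4, 6, 0, 2, 6], [0, 3, 6, 2, 0],
      [2, 4, 0, 2, 4], [4, 0, 6, 4, 2], [2, 6, 0, 4, 1], [3, 1, 6, 0, 4], [6, 0, 3, 6, 2],
      [0, 2, 4, 0, 2], [6, 3, 0, 2, 6], [3, 1, 6, 0, 2]] : List (List ℕ)),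
      Fits a b c d s ∧ Repeats s := by
  decide +kernel

theorem fits_six : ∀ a b c d : Fin 7, Core a b c d →
    (∃ x y : Fin 4, x ≠ y ∧ Ends a b c d (2 * x) (2 * y)) →
    ∃ s ∈ ([[0, 2, 6, 3, 0, 4], [6, 2, 0, 3, 6, 2], [2, 4, 0, 3, 1, 6], [4, 0, 6, 1, 5, 0],
      [0, 2, 6, 0, 4, 6], [6, 0, 3, 1, 6, 0], [2, 0, 4, 2, 5, 3], [4, 2, 0, 6, 4, 2],
      [0, 2, 4, 1, 5, 0], [6, 1, 3, 0, 2, 6], [4, 0, 6, 4, 0, 5], [0, 4, 2, 5, 3, 0],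
      [2, 0, 4, 2, 0, 6], [1, 6, 3, 1, 4, 0], [3, 0, 5, 1, 4, 0], [5, 0, 3, 5, 2, 4],
      [0, 2, 4, 0, 3, 1]] : List (List ℕ)),
      Fits a b c d s ∧ Repeats s := by
  decide +kernel

theorem exists_fits {a b c d x y : ℕ} (n : ℕ) (hn : 2 ≤ n) (ha : a ≤ 6) (hb : b ≤ 6) (hc : c ≤ 6)
    (hd : d ≤ 6) (h : Core a b c d) (hx : x = 0 ∨ x = 2 ∨ x = 4 ∨ x = 6)
    (hy : y = 0 ∨ y = 2 ∨ y = 4 ∨ y = 6) (hxy : x = y ↔ (n + 2) % 3 = 0)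
    (he : Ends a b c d x y) : ∃ s : List ℕ, s.length = n ∧ Fits a b c d s := by
  have hne : x ≠ y → ∃ x y : Fin 4, x ≠ y ∧ Ends a b c d (2 * x) (2 * y) := fun hn =>
    ⟨⟨x / 2, by omega⟩, ⟨y / 2, by omega⟩, by simp only [ne_eq, Fin.mk.injEq]; omega, by
      simpa [show 2 * (x / 2) = x by omega, show 2 * (y / 2) = y by omega] using he⟩
  have heq : x = y → ∃ x : Fin 4, Ends a b c d (2 * x) (2 * x) := fun hn =>
    ⟨⟨x / 2, by omega⟩, by
      subst hn
      simpa [show 2 * (x / 2) = x by omega] using he⟩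
  let a' : Fin 7 := ⟨a, by omega⟩
  let b' : Fin 7 := ⟨b, by omega⟩
  let c' : Fin 7 := ⟨c, by omega⟩
  let d' : Fin 7 := ⟨d, by omega⟩
  have main : ∀ n, 4 ≤ n → (x = y ↔ (n + 2) % 3 = 0) →
      ∃ s : List ℕ, s.length = n ∧ Fits a b c d s ∧ Repeats s := by
    intro n
    induction n using Nat.strong_induction_on with
    | _ n ih =>
      intro hn hxy
      rcases (by omega : n = 4 ∨ n = 5 ∨ n = 6 ∨ 7 ≤ n) with rfl | rfl | rfl | h7
      · obtain ⟨s, hs, hs'⟩ := fits_four a' b' c' d' h (heq (by omega))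
        exact ⟨s, by revert s; simp, hs'⟩
      · obtain ⟨s, hs, hs'⟩ := fits_five a' b' c' d' h (hne (by omega))
        exact ⟨s, by clear hs'; revert s; simp, hs'⟩
      · obtain ⟨s, hs, hs'⟩ := fits_six a' b' c' d' h (hne (by omega))
        exact ⟨s, by clear hs'; revert s; simp, hs'⟩
      · obtain ⟨s, hs, hf, hr⟩ := ih (n - 3) (by omega) (by omega) (by omega)
        obtain ⟨s', hs', hf', hr'⟩ := hf.insert_period hr
        exact ⟨s', by omega, hf', hr'⟩
  rcases (by omega : n = 2 ∨ n = 3 ∨ 4 ≤ n) with rfl | rfl | h4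
  · obtain ⟨s, hs, hs'⟩ := fits_two a' b' c' d' h (hne (by omega))
    exact ⟨s, by clear hs'; revert s; simp, hs'⟩
  · obtain ⟨s, hs, hs'⟩ := fits_three a' b' c' d' h (hne (by omega))
    exact ⟨s, by clear hs'; revert s; simp, hs'⟩
  · obtain ⟨s, hs, hf, -⟩ := main n h4 hxy
    exact ⟨s, hs, hf⟩

theorem PathOk.getD {L : List ℕ} (h : PathOk L) (hL : 3 ≤ L.length) :
    (∀ i, i + 1 < L.length → LabelSep (L.getD i 0) (L.getD (i + 1) 0)) ∧
    (∀ i, i + 2 < L.length → L.getD i 0 ≠ L.getD (i + 2) 0) ∧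
    (∀ i, i + 3 < L.length →
      Window (L.getD i 0) (L.getD (i + 1) 0) (L.getD (i + 2) 0) (L.getD (i + 3) 0)) := by
  match L, h with
  | a :: b :: c :: d :: t, h =>
    obtain ⟨h1, h2, h3, h4⟩ := h
    obtain ⟨k1, k2, k3⟩ := PathOk.getD h4 (by simp)
    refine ⟨?_, ?_, ?_⟩ <;> intro i hi <;> cases i with
    | zero => first | exact h1 | exact h2 | exact h3
    | succ i =>
      have hi' := Nat.lt_of_succ_lt_succ hi
      first | exact k1 i hi' | exact k2 i hi' | exact k3 i hi'
  | [a, b, c], h =>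
    obtain ⟨h1, h2, h3⟩ := h
    refine ⟨?_, ?_, ?_⟩ <;> intro i hi <;> simp only [List.length_cons, List.length_nil] at hi
    · rcases (by omega : i = 0 ∨ i = 1) with rfl | rfl
      exacts [h1, h3]
    · obtain rfl : i = 0 := by omega
      exact h2
    · omega
  | [], _ => simp at hL
  | [_], _ => simp at hL
  | [_, _], _ => simp at hL

theorem isL21Labeling_iff {V : Type*} {G : SimpleGraph V} {f : V → ℕ} :
    IsL21Labeling G f ↔ (∀ a b, G.Adj a b → LabelSep (f a) (f b)) ∧
      ∀ a z b, G.Adj a z → G.Adj z b → a ≠ b → f a ≠ f b := by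
  have hsep : ∀ m n : ℕ, 2 ≤ ((m : ℤ) - (n : ℤ)).natAbs ↔ LabelSep m n := by
    unfold LabelSep; intros; omega
  simp only [IsL21Labeling, hsep]
  refine and_congr_right fun h1 => ⟨fun h2 a z b haz hzb hab => ?_, fun h2 a b hd => ?_⟩
  · by_cases hadj : G.Adj a b
    · have := h1 a b hadj
      unfold LabelSep at this
      omega
    · refine h2 a b ?_
      let w : G.Walk a b := .cons haz (.cons hzb .nil)
      have hle : G.dist a b ≤ 2 := SimpleGraph.dist_le w
      have h0 : G.dist a b ≠ 0 := fun h => hab (w.reachable.dist_eq_zero_iff.1 h)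
      have h1 : G.dist a b ≠ 1 := fun h => hadj (SimpleGraph.dist_eq_one_iff_adj.1 h)
      omega
  · obtain ⟨w, hw⟩ := SimpleGraph.exists_walk_of_dist_ne_zero (by omega : G.dist a b ≠ 0)
    rw [hd] at hw
    match w, hw with
    | .cons haz (.cons hzb .nil), _ =>
      refine h2 _ _ _ haz hzb ?_
      rintro rfl
      simp at hd

theorem pathGraph_adj {n : ℕ} {p q : Fin n} :
    (PathGraph n).Adj p q ↔ (p : ℕ) + 1 = q ∨ (q : ℕ) + 1 = p := by
  simp only [PathGraph, SimpleGraph.fromRel_adj, ne_eq, Fin.ext_iff]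
  omega

theorem attachG_adj_inl_inl {l : ℕ} {D : ℕ → Option Bool} {p q : Fin (l + 2)} :
    (AttachG l D).Adj (Sum.inl p) (Sum.inl q) ↔ (p : ℕ) + 1 = q ∨ (q : ℕ) + 1 = p := by
  simp only [AttachG, SimpleGraph.fromRel_adj, ne_eq, Sum.inl.injEq, Fin.ext_iff, attachRel]
  omega

theorem attachG_adj_inl_inr {l : ℕ} {D : ℕ → Option Bool} {p : Fin (l + 2)} {i : ℕ} {k : Bool} :
    (AttachG l D).Adj (Sum.inl p) (Sum.inr (i, k)) ↔ ((p : ℕ) = i ∧ k = false) ∨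
      ((p : ℕ) = i + 1 ∧ ((D i = some false ∧ k = false) ∨ (D i = some true ∧ k = true))) := by
  simp [AttachG, SimpleGraph.fromRel_adj, attachRel]

theorem attachG_adj_inr_inr {l : ℕ} {D : ℕ → Option Bool} {i j : ℕ} {k m : Bool} :
    (AttachG l D).Adj (Sum.inr (i, k)) (Sum.inr (j, m)) ↔
      i = j ∧ D i = some true ∧ k ≠ m := by
  simp only [AttachG, SimpleGraph.fromRel_adj, attachRel]
  cases k <;> cases m <;> simp; all_goals grind

/-- Local conditions under which a labeling of all potential vertices restricts to a labeling of
the graph described by `D`. -/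
theorem extendsToAttach_of_local {l : ℕ} {D : ℕ → Option Bool} {F : ℕ → ℕ} {g : PVert l → ℕ}
    (h6 : ∀ i, i < l + 2 → F i ≤ 6)
    (h1 : ∀ i, i + 1 < l + 2 → LabelSep (F i) (F (i + 1)))
    (h2 : ∀ i, i + 2 < l + 2 → F i ≠ F (i + 2))
    (hD : ∀ i, ¬ ((D i).isSome ∧ (D (i + 1)).isSome))
    (hval : ∀ i k, Active (l := l) D (Sum.inr (i, k)) → 1 ≤ i ∧ g (Sum.inr (i, k)) ≤ 6 ∧
      (k = false → LabelSep (g (Sum.inr (i, k))) (F i) ∧ g (Sum.inr (i, k)) ≠ F (i - 1) ∧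
        g (Sum.inr (i, k)) ≠ F (i + 1)) ∧
      (D i = some false ∨ k = true → LabelSep (g (Sum.inr (i, k))) (F (i + 1)) ∧
        g (Sum.inr (i, k)) ≠ F i ∧ g (Sum.inr (i, k)) ≠ F (i + 2)))
    (hpair : ∀ i, D i = some true → LabelSep (g (Sum.inr (i, false))) (g (Sum.inr (i, true))))
    (hinl : ∀ p, g (Sum.inl p) = F p) : ExtendsToAttach l D (fun p => F p) := by
  have hadj : ∀ (p : Fin (l + 2)) i k, Active (l := l) D (Sum.inr (i, k)) →
      (AttachG l D).Adj (Sum.inl p) (Sum.inr (i, k)) →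
      LabelSep (g (Sum.inl p)) (g (Sum.inr (i, k))) := by
    intro p i k ha h
    obtain ⟨-, -, hv1, hv2⟩ := hval i k ha
    rw [hinl]
    rcases attachG_adj_inl_inr.1 h with ⟨hp, hk⟩ | ⟨hp, hk⟩
    · rw [hp]
      exact (hv1 hk).1.symm
    · rw [hp]
      exact (hv2 (by tauto)).1.symm
  have hfar : ∀ (p q : Fin (l + 2)) i k, Active (l := l) D (Sum.inr (i, k)) →
      (AttachG l D).Adj (Sum.inl p) (Sum.inl q) →
      (AttachG l D).Adj (Sum.inl q) (Sum.inr (i, k)) →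
      g (Sum.inl p) ≠ g (Sum.inr (i, k)) := by
    intro p q i k ha hpq h
    obtain ⟨hi, -, hv1, hv2⟩ := hval i k ha
    rw [attachG_adj_inl_inl] at hpq
    rw [hinl]
    rcases attachG_adj_inl_inr.1 h with ⟨hq, hk⟩ | ⟨hq, hk⟩
    · rcases (by omega : (p : ℕ) = i - 1 ∨ (p : ℕ) = i + 1) with hp | hp <;> rw [hp]
      exacts [(hv1 hk).2.1.symm, (hv1 hk).2.2.symm]
    · rcases (by omega : (p : ℕ) = i ∨ (p : ℕ) = i + 2) with hp | hp <;> rw [hp]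
      exacts [(hv2 (by tauto)).2.1.symm, (hv2 (by tauto)).2.2.symm]
  have hnew : ∀ (p : Fin (l + 2)) i j k m, Active (l := l) D (Sum.inr (i, k)) →
      Active (l := l) D (Sum.inr (j, m)) → (AttachG l D).Adj (Sum.inl p) (Sum.inr (i, k)) →
      (AttachG l D).Adj (Sum.inr (i, k)) (Sum.inr (j, m)) →
      g (Sum.inl p) ≠ g (Sum.inr (j, m)) := by
    intro p i j k m _ hb h h'
    obtain ⟨rfl, hD', hkm⟩ := attachG_adj_inr_inr.1 h'
    obtain ⟨-, -, hv1, hv2⟩ := hval i m hb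
    rw [hinl]
    rcases attachG_adj_inl_inr.1 h with ⟨hp, hk⟩ | ⟨hp, hk⟩ <;> rw [hp]
    · exact (hv2 (Or.inr (by clear * - hk hkm; grind))).2.1.symm
    · exact (hv1 (by clear * - hk hkm hD'; grind)).2.2.symm
  refine ⟨fun w => g w, ⟨isL21Labeling_iff.2 ⟨?_, ?_⟩, ?_⟩, hinl⟩
  · rintro ⟨p | ⟨i, k⟩, ha⟩ ⟨q | ⟨j, m⟩, hb⟩ hab <;>
      simp only [SimpleGraph.comap_adj, Function.Embedding.subtype_apply] at hab
    · rw [attachG_adj_inl_inl] at hab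
      rw [hinl, hinl]
      rcases hab with h | h
      · rw [← h]
        exact h1 p (by omega)
      · rw [← h]
        exact (h1 q (by omega)).symm
    · exact hadj p j m hb hab
    · exact (hadj q i k ha hab.symm).symm
    · obtain ⟨rfl, hD', hkm⟩ := attachG_adj_inr_inr.1 hab
      cases k <;> cases m <;> simp only [ne_eq, not_true_eq_false] at hkm
      exacts [hpair i hD', (hpair i hD').symm]
  · rintro ⟨p | ⟨i, k⟩, ha⟩ ⟨z | ⟨n, u⟩, hz⟩ ⟨q | ⟨j, m⟩, hb⟩ haz hzb hab <;>
      simp only [SimpleGraph.comap_adj, Function.Embedding.subtype_apply] at haz hzb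
    · rw [attachG_adj_inl_inl] at haz hzb
      rw [hinl, hinl]
      have hpq : (p : ℕ) ≠ q := fun h => hab (by simp [Fin.ext h])
      rcases (by omega : (p : ℕ) + 2 = q ∨ (q : ℕ) + 2 = p) with h | h
      · rw [← h]
        exact h2 p (by omega)
      · rw [← h]
        exact (h2 q (by omega)).symm
    · exact hfar p z j m hb haz hzb
    · have hzb' := hzb.symm
      rw [attachG_adj_inl_inr] at haz hzb'
      rw [hinl, hinl]
      have hpq : (p : ℕ) ≠ q := fun h => hab (by simp [Fin.ext h])
      rcases (by omega : (p : ℕ) + 1 = q ∨ (q : ℕ) + 1 = p) with h | h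
      · have := h1 p (by omega)
        rw [h] at this
        unfold LabelSep at this
        omega
      · have := h1 q (by omega)
        rw [h] at this
        unfold LabelSep at this
        omega
    · exact hnew p n j u m hz hb haz hzb
    · exact (hfar q z i k ha hzb.symm haz.symm).symm
    · exfalso
      have haz' := haz.symm
      rw [attachG_adj_inl_inr] at haz' hzb
      have hij : i ≠ j + 1 := fun h => hD j ⟨hb.1, h ▸ ha.1⟩
      have hji : j ≠ i + 1 := fun h => hD i ⟨ha.1, h ▸ hb.1⟩
      have : i = j := by omega
      subst this
      refine hab ?_
      have : k = m := by
        clear * - haz' hzb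
        grind
      subst this
      rfl
    · exact (hnew q n i u k hz ha hzb.symm haz.symm).symm
    · obtain ⟨rfl, -, hku⟩ := attachG_adj_inr_inr.1 haz
      obtain ⟨rfl, -, hum⟩ := attachG_adj_inr_inr.1 hzb
      refine absurd ?_ hab
      have : k = m := by
        clear * - hku hum
        cases k <;> cases u <;> cases m <;> simp_all
      subst this
      rfl
  · rintro ⟨p | ⟨i, k⟩, ha⟩
    · exact (hinl p).trans_le (h6 p p.2)
    · exact (hval i k ha).2.1

/-- A labeling of a path satisfying the local conditions is path-extendable. -/
theorem pathExtendable_of_window {l : ℕ} {F : ℕ → ℕ} (h6 : ∀ i, i < l + 2 → F i ≤ 6)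
    (h1 : ∀ i, i + 1 < l + 2 → LabelSep (F i) (F (i + 1)))
    (h2 : ∀ i, i + 2 < l + 2 → F i ≠ F (i + 2))
    (h3 : ∀ i, i + 3 < l + 2 → Window (F i) (F (i + 1)) (F (i + 2)) (F (i + 3))) :
    PathExtendable l (fun p => F p) := by
  refine ⟨⟨isL21Labeling_iff.2 ⟨fun a b hab => ?_, fun a z b haz hzb hab => ?_⟩,
    fun a => h6 a a.2⟩, fun D hD => ?_⟩
  · rcases pathGraph_adj.1 hab with h | h
    · have := h1 a (by omega)
      rwa [h] at this
    · have := h1 b (by omega)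
      rw [h] at this
      exact this.symm
  · rw [pathGraph_adj] at haz hzb
    rw [ne_eq, Fin.ext_iff] at hab
    rcases (by omega : (a : ℕ) + 2 = b ∨ (b : ℕ) + 2 = a) with h | h
    · have := h2 a (by omega)
      rwa [h] at this
    · have := h2 b (by omega)
      rw [h] at this
      exact this.symm
  have hX : ∀ i, ∃ x y z : ℕ, 1 ≤ i → i + 1 ≤ l →
      (x < 7 ∧ LabelSep x (F i) ∧ LabelSep x (F (i + 1)) ∧ x ≠ F (i - 1) ∧ x ≠ F (i + 2)) ∧
      (y < 7 ∧ LabelSep y (F i) ∧ y ≠ F (i - 1) ∧ y ≠ F (i + 1)) ∧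
      (z < 7 ∧ LabelSep z (F (i + 1)) ∧ LabelSep y z ∧ z ≠ F i ∧ z ≠ F (i + 2)) := by
    intro i
    by_cases hi : 1 ≤ i ∧ i + 1 ≤ l
    · obtain ⟨k, rfl⟩ := Nat.exists_eq_add_of_le' hi.1
      obtain ⟨⟨x, x1, x2, x3, x4, x5⟩, y, y1, y2, y3, y4, z, z1, z2, z3, z4, z5⟩ :=
        h3 k (by omega)
      exact ⟨x, y, z, fun _ _ => ⟨⟨x1, x2, x3, x4, x5⟩, ⟨y1, y2, y3, y4⟩, z1, z2, z3, z4, z5⟩⟩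
    · exact ⟨0, 0, 0, fun ha hb => absurd ⟨ha, hb⟩ hi⟩
  choose X Y Z hXYZ using hX
  let g : PVert l → ℕ := fun w => match w with
    | Sum.inl p => F p
    | Sum.inr (i, k) => if D i = some true then (if k then Z i else Y i) else X i
  obtain ⟨hD1, hD2⟩ := hD
  refine extendsToAttach_of_local (g := g) h6 h1 h2 hD2 ?_ ?_ (fun p => rfl)
  · rintro i k ⟨hi, hk⟩
    obtain ⟨hi1, hil⟩ := hD1 i hi
    obtain ⟨hx, hy, hz⟩ := hXYZ i hi1 hil
    refine ⟨hi1, ?_⟩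
    unfold LabelSep at *
    cases hd : D i with
    | none => simp [hd] at hi
    | some b => cases b <;> cases k <;> simp [g, hd] at hk ⊢ <;> omega
  · intro i hi
    obtain ⟨hi1, hil⟩ := hD1 i (by simp [hi])
    simpa [g, hi] using (hXYZ i hi1 hil).2.2.2.2.1

theorem hcyc_adj_inl_inl {l : ℕ} (hl : 4 ≤ l) {p q : Fin l} :
    (HCyc l).Adj (Sum.inl p) (Sum.inl q) ↔ (p : ℕ) + 1 = q ∨ (q : ℕ) + 1 = p ∨
      ((p : ℕ) = 0 ∧ (q : ℕ) = l - 1) ∨ ((q : ℕ) = 0 ∧ (p : ℕ) = l - 1) := by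
  have hmod : ∀ r : Fin l, ((r : ℕ) + 1 < l ∧ ((r : ℕ) + 1) % l = r + 1) ∨
      ((r : ℕ) = l - 1 ∧ ((r : ℕ) + 1) % l = 0) := by
    intro r
    rcases (by omega : (r : ℕ) + 1 < l ∨ (r : ℕ) + 1 = l) with h | h
    · exact Or.inl ⟨h, Nat.mod_eq_of_lt h⟩
    · exact Or.inr ⟨by omega, by rw [h, Nat.mod_self]⟩
  simp only [HCyc, SimpleGraph.fromRel_adj, ne_eq, Sum.inl.injEq, Fin.ext_iff, hcycRel]
  have := hmod p
  have := hmod q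
  omega

theorem hcyc_adj_inl_inr {l : ℕ} {p : Fin l} {b : Bool} :
    (HCyc l).Adj (Sum.inl p) (Sum.inr b) ↔ (p : ℕ) = if b then 1 else 0 := by
  cases b <;> simp [HCyc, hcycRel]

theorem hcyc_adj_inr_inr {l : ℕ} {b c : Bool} :
    ¬ (HCyc l).Adj (Sum.inr b) (Sum.inr c) := by
  cases b <;> cases c <;> simp [HCyc, hcycRel]

/-- Local conditions for a labeling of the cycle with two pendant vertices. -/
theorem hcyc_isKL21Labeling {l : ℕ} (hl : 4 ≤ l) {h : ℕ → ℕ} {a d : ℕ}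
    (h6 : ∀ i, i < l → h i ≤ 6) (ha : a ≤ 6) (hd : d ≤ 6)
    (h1 : ∀ i, i + 1 < l → LabelSep (h i) (h (i + 1))) (h1' : LabelSep (h (l - 1)) (h 0))
    (h2 : ∀ i, i + 2 < l → h i ≠ h (i + 2)) (h2' : h (l - 2) ≠ h 0) (h2'' : h (l - 1) ≠ h 1)
    (ha1 : LabelSep a (h 0)) (ha2 : a ≠ h 1) (ha3 : a ≠ h (l - 1))
    (hd1 : LabelSep d (h 1)) (hd2 : d ≠ h 0) (hd3 : d ≠ h 2) :
    IsKL21Labeling (HCyc l) 6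
      (Sum.elim (fun p => h p) (fun b => if b then d else a)) := by
  have hcyc : ∀ p q : Fin l, (p : ℕ) + 1 = q ∨ ((q : ℕ) = 0 ∧ (p : ℕ) = l - 1) →
      LabelSep (h p) (h q) := by
    rintro p q (hpq | ⟨hq, hp⟩)
    · rw [← hpq]
      exact h1 p (by omega)
    · rwa [hp, hq]
  have hcyc' : ∀ p q : Fin l, (HCyc l).Adj (Sum.inl p) (Sum.inl q) → LabelSep (h p) (h q) := by
    intro p q hpq
    rw [hcyc_adj_inl_inl hl] at hpq
    rcases (by omega : ((p : ℕ) + 1 = q ∨ ((q : ℕ) = 0 ∧ (p : ℕ) = l - 1)) ∨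
      ((q : ℕ) + 1 = p ∨ ((p : ℕ) = 0 ∧ (q : ℕ) = l - 1))) with hh | hh
    exacts [hcyc p q hh, (hcyc q p hh).symm]
  have htwo : ∀ p q : Fin l, (p : ℕ) + 2 = q ∨ ((p : ℕ) = l - 2 ∧ (q : ℕ) = 0) ∨
      ((p : ℕ) = l - 1 ∧ (q : ℕ) = 1) → h p ≠ h q := by
    rintro p q (hpq | ⟨hp, hq⟩ | ⟨hp, hq⟩)
    · rw [← hpq]
      exact h2 p (by omega)
    · rwa [hp, hq]
    · rwa [hp, hq]
  have hpend : ∀ (p : Fin l) (b : Bool), (p : ℕ) = (if b then 1 else 0) →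
      LabelSep (h p) (if b then d else a) := by
    intro p b hp
    rw [hp]
    cases b
    exacts [ha1.symm, hd1.symm]
  have hfar : ∀ (p q : Fin l) (b : Bool), (HCyc l).Adj (Sum.inl p) (Sum.inl q) →
      (q : ℕ) = (if b then 1 else 0) → h p ≠ (if b then d else a) := by
    intro p q b hpq hq
    rw [hcyc_adj_inl_inl hl] at hpq
    cases b
    · rcases (by grind : (p : ℕ) = 1 ∨ (p : ℕ) = l - 1) with hp | hp <;> rw [hp]
      exacts [ha2.symm, ha3.symm]
    · rcases (by grind : (p : ℕ) = 0 ∨ (p : ℕ) = 2) with hp | hp <;> rw [hp]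
      exacts [hd2.symm, hd3.symm]
  refine ⟨isL21Labeling_iff.2 ⟨?_, ?_⟩, ?_⟩
  · rintro (p | b) (q | c) hpq
    · exact hcyc' p q hpq
    · exact hpend p c (hcyc_adj_inl_inr.1 hpq)
    · exact (hpend q b (hcyc_adj_inl_inr.1 hpq.symm)).symm
    · exact absurd hpq hcyc_adj_inr_inr
  · rintro (p | b) (z | e) (q | c) hpz hzq hpq
    · rw [hcyc_adj_inl_inl hl] at hpz hzq
      have hne : (p : ℕ) ≠ q := fun hh => hpq (by rw [Fin.ext hh])
      rcases (by omega : ((p : ℕ) + 2 = q ∨ ((p : ℕ) = l - 2 ∧ (q : ℕ) = 0) ∨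
        ((p : ℕ) = l - 1 ∧ (q : ℕ) = 1)) ∨ ((q : ℕ) + 2 = p ∨ ((q : ℕ) = l - 2 ∧ (p : ℕ) = 0) ∨
        ((q : ℕ) = l - 1 ∧ (p : ℕ) = 1))) with hh | hh
      exacts [htwo p q hh, (htwo q p hh).symm]
    · exact hfar p z c hpz (hcyc_adj_inl_inr.1 hzq)
    · have h₁ := hcyc_adj_inl_inr.1 hpz
      have h₂ := hcyc_adj_inl_inr.1 hzq.symm
      exact absurd (by rw [Fin.ext (h₁.trans h₂.symm)]) hpq
    · exact absurd hzq hcyc_adj_inr_inr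
    · exact (hfar q z b hzq.symm (hcyc_adj_inl_inr.1 hpz.symm)).symm
    · have h₁ := hcyc_adj_inl_inr.1 hpz.symm
      have h₂ := hcyc_adj_inl_inr.1 hzq
      refine absurd ?_ hpq
      cases b <;> cases c <;> simp_all
    · exact absurd hpz hcyc_adj_inr_inr
    · exact absurd hpz hcyc_adj_inr_inr
  · rintro (p | b)
    · exact h6 p p.2
    · cases b
      exacts [ha, hd]

/-- A labeling of the neighbourhood of the edge `u_1 u_2` satisfies the local conditions. -/
theorem core_and_ends_of_labeling {l : ℕ} (hl : 4 ≤ l) {g : ↥(S6 l) → ℕ}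
    (hg : IsL21Labeling ((HCyc l).induce (S6 l)) g) {a b c d x y : ℕ}
    (ha : g ⟨Sum.inr false, Or.inl rfl⟩ = a)
    (hb : g ⟨Sum.inl ⟨0, by omega⟩, memS6inl l _ (Or.inl rfl)⟩ = b)
    (hc : g ⟨Sum.inl ⟨1, by omega⟩, memS6inl l _ (Or.inr (Or.inl rfl))⟩ = c)
    (hd : g ⟨Sum.inr true, Or.inr (Or.inl rfl)⟩ = d)
    (hx : g ⟨Sum.inl ⟨2, by omega⟩, memS6inl l _ (Or.inr (Or.inr (Or.inl rfl)))⟩ = x)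
    (hy : g ⟨Sum.inl ⟨l - 1, by omega⟩, memS6inl l _ (Or.inr (Or.inr (Or.inr rfl)))⟩ = y)
    (hodd : b % 2 = 1 ∨ c % 2 = 1) : Core a b c d ∧ Ends a b c d x y := by
  obtain ⟨hadj, hdist⟩ := isL21Labeling_iff.1 hg
  have sep : ∀ {p q : Fin l ⊕ Bool} (hp : p ∈ S6 l) (hq : q ∈ S6 l), (HCyc l).Adj p q →
      LabelSep (g ⟨p, hp⟩) (g ⟨q, hq⟩) := fun _ _ h => hadj _ _ h
  have far : ∀ {p z q : Fin l ⊕ Bool} (hp : p ∈ S6 l) (_ : z ∈ S6 l) (hq : q ∈ S6 l),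
      (HCyc l).Adj p z → (HCyc l).Adj z q → p ≠ q → g ⟨p, hp⟩ ≠ g ⟨q, hq⟩ :=
    fun _ hz _ h h' hne => hdist _ ⟨_, hz⟩ _ h h' fun e => hne (congrArg Subtype.val e)
  have m1 := memS6inl l ⟨0, by omega⟩ (Or.inl rfl)
  have m2 := memS6inl l ⟨1, by omega⟩ (Or.inr (Or.inl rfl))
  have a11 : (HCyc l).Adj (Sum.inl ⟨0, by omega⟩) (Sum.inr false) := hcyc_adj_inl_inr.2 rfl
  have a22 : (HCyc l).Adj (Sum.inl ⟨1, by omega⟩) (Sum.inr true) := hcyc_adj_inl_inr.2 rfl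
  have a12 : (HCyc l).Adj (Sum.inl ⟨0, by omega⟩) (Sum.inl ⟨1, by omega⟩) :=
    (hcyc_adj_inl_inl hl).2 (Or.inl rfl)
  have a23 : (HCyc l).Adj (Sum.inl ⟨1, by omega⟩) (Sum.inl ⟨2, by omega⟩) :=
    (hcyc_adj_inl_inl hl).2 (Or.inl rfl)
  have a1l : (HCyc l).Adj (Sum.inl ⟨0, by omega⟩) (Sum.inl ⟨l - 1, by omega⟩) :=
    (hcyc_adj_inl_inl hl).2 (Or.inr (Or.inr (Or.inl ⟨rfl, rfl⟩)))
  have h1l : (Sum.inl ⟨l - 1, by omega⟩ : Fin l ⊕ Bool) ≠ Sum.inl ⟨1, by omega⟩ := fun e => by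
    have := Fin.mk.inj (Sum.inl.inj e)
    omega
  subst ha hb hc hd hx hy
  exact ⟨⟨sep _ _ a12, hodd, sep _ _ a11.symm, sep _ _ a22,
      far _ m1 _ a11.symm a12 Sum.inr_ne_inl, far _ m2 _ a12 a22 Sum.inl_ne_inr⟩,
    sep _ _ a23.symm, far _ m2 _ a23.symm a12.symm (by simp),
      far _ m2 _ a23.symm a22 Sum.inl_ne_inr, sep _ _ a1l.symm,
      far _ m1 _ a1l.symm a12 h1l, far _ m1 _ a1l.symm a11 Sum.inl_ne_inr⟩

/-- An admissible choice of the labels of `u_3, ..., u_l` gives the required labeling. -/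
theorem Fits.exists_labeling {l : ℕ} (hl : 4 ≤ l) {a b c d : ℕ} {s : List ℕ} (k0 : a ≤ 6)
    (k1 : b ≤ 6) (k2 : c ≤ 6) (k3 : d ≤ 6) (h : Core a b c d) (hs : s.length = l - 2)
    (hfit : Fits a b c d s) :
    ∃ f1 : Fin l ⊕ Bool → ℕ,
      IsKL21Labeling (HCyc l) 6 f1 ∧
      f1 (Sum.inr false) = a ∧
      f1 (Sum.inl ⟨0, by omega⟩) = b ∧
      f1 (Sum.inl ⟨1, by omega⟩) = c ∧
      f1 (Sum.inr true) = d ∧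
      PathExtendable (l - 2)
        (fun m : Fin (l - 2 + 2) => f1 (Sum.inl ⟨((m : ℕ) + 1) % l, Nat.mod_lt _ (by omega)⟩)) := by
  obtain ⟨b12, -, b11, b22, c1, c2⟩ := h
  obtain ⟨s6, s1, s2, s3, s4, hok⟩ := hfit
  set L : List ℕ := c :: (s ++ [b]) with hLdef
  have hL : L.length = l := by simp [L, hs]; omega
  obtain ⟨p1, p2, p3⟩ := hok.getD (by omega)
  rw [hL] at p1 p2 p3
  have q0 : L.getD 0 0 = c := rfl
  have q1 : L.getD (l - 1) 0 = b := by
    obtain ⟨n, rfl⟩ := Nat.exists_eq_add_of_le' hl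
    simp [L, show n + 4 - 2 = n + 2 by omega] at hs ⊢
    simp [hs]
  have q2 : ∀ z, s.headD z = L.getD 1 0 := by
    intro z
    cases s with
    | nil => simp at hs; omega
    | cons w t => rfl
  have q3 : ∀ z, s.getLastD z = L.getD (l - 2) 0 := by
    intro z
    obtain ⟨n, rfl⟩ := Nat.exists_eq_add_of_le' hl
    simp only [show n + 4 - 2 = n + 2 by omega] at hs ⊢
    simp [L, hs, List.getLastD_eq_getLast?, List.getLast?_eq_getElem?]
  rw [q2] at s1 s2
  rw [q3] at s3 s4
  have hL6 : ∀ i, i < l → L.getD i 0 ≤ 6 := by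
    intro i hi
    have : ∀ w ∈ L, w ≤ 6 := by
      intro w hw
      simp only [L, List.mem_cons, List.mem_append, List.not_mem_nil, or_false] at hw
      rcases hw with rfl | hw | rfl
      exacts [k2, s6 w hw, k1]
    rw [List.getD_eq_getElem _ _ (by omega)]
    exact this _ (List.getElem_mem _)
  clear_value L
  let h : ℕ → ℕ := fun i => if i = 0 then b else L.getD (i - 1) 0
  have hsucc : ∀ i, h (i + 1) = L.getD i 0 := fun i => by simp [h]
  have h0 : h 0 = b := rfl
  have hpre : ∀ i, 1 ≤ i → h i = L.getD (i - 1) 0 := fun i hi => by simp [h]; omega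
  refine ⟨Sum.elim (fun p => h p) (fun b => if b then d else a),
    hcyc_isKL21Labeling hl ?_ k0 k3 ?_ ?_ ?_ ?_ ?_ ?_ ?_ ?_ ?_ ?_ ?_, rfl, rfl, q0, rfl, ?_⟩
  · rintro (_ | i) hi
    · exact k1
    · exact hsucc i ▸ hL6 i (by omega)
  · rintro (_ | i) hi
    · exact hsucc 0 ▸ q0 ▸ b12
    · rw [hsucc, hsucc]
      exact p1 i (by omega)
  · have := p1 (l - 2) (by omega)
    rwa [show l - 2 + 1 = l - 1 by omega, q1, ← show l - 1 - 1 = l - 2 by omega,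
      ← hpre (l - 1) (by omega)] at this
  · rintro (_ | i) hi
    · exact hsucc 1 ▸ s1.symm
    · rw [hsucc, hsucc]
      exact p2 i (by omega)
  · have := p2 (l - 3) (by omega)
    rwa [show l - 3 + 2 = l - 1 by omega, q1, ← show l - 2 - 1 = l - 3 by omega,
      ← hpre (l - 2) (by omega)] at this
  · rw [hpre (l - 1) (by omega), hsucc 0, q0]
    exact s4
  · exact b11
  · rw [hsucc 0, q0]
    exact c1
  · rw [hpre (l - 1) (by omega)]
    exact s3.symm
  · rw [hsucc 0, q0]
    exact b22.symm
  · exact c2.symm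
  · exact hsucc 1 ▸ s2.symm
  · have := pathExtendable_of_window (l := l - 2) (F := fun i => L.getD i 0)
      (fun i hi => hL6 i (by omega)) (fun i hi => p1 i (by omega)) (fun i hi => p2 i (by omega))
      (fun i hi => p3 i (by omega))
    convert this using 2 with m
    rcases (by omega : (m : ℕ) + 1 < l ∨ (m : ℕ) + 1 = l) with hm | hm
    · simp only [Sum.elim_inl, Nat.mod_eq_of_lt hm, hsucc]
    · simp only [Sum.elim_inl, hm, Nat.mod_self, h0, ← q1]
      exact congrArg (L.getD · 0) (by omega)

theorem stmt15 (l : ℕ) (hl : 4 ≤ l) (f : Fin 4 → ℕ)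
    (hf : PathExtendable 2 f)
    (hmid : f 1 = 1 ∨ f 1 = 3 ∨ f 1 = 5 ∨ f 2 = 1 ∨ f 2 = 3 ∨ f 2 = 5)
    (hg : ∃ g : ↥(S6 l) → ℕ,
      IsKL21Labeling ((HCyc l).induce (S6 l)) 6 g ∧
      g ⟨Sum.inr false, Or.inl rfl⟩ = f 0 ∧
      g ⟨Sum.inl ⟨0, by omega⟩, memS6inl l _ (Or.inl rfl)⟩ = f 1 ∧
      g ⟨Sum.inl ⟨1, by omega⟩, memS6inl l _ (Or.inr (Or.inl rfl))⟩ = f 2 ∧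
      g ⟨Sum.inr true, Or.inr (Or.inl rfl)⟩ = f 3 ∧
      ∃ c3 cl : ℕ,
        g ⟨Sum.inl ⟨2, by omega⟩, memS6inl l _ (Or.inr (Or.inr (Or.inl rfl)))⟩ = c3 ∧
        g ⟨Sum.inl ⟨l - 1, by omega⟩, memS6inl l _ (Or.inr (Or.inr (Or.inr rfl)))⟩ = cl ∧
        (c3 = 0 ∨ c3 = 2 ∨ c3 = 4 ∨ c3 = 6) ∧
        (cl = 0 ∨ cl = 2 ∨ cl = 4 ∨ cl = 6) ∧
        (c3 = cl ↔ l % 3 = 0)) :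
    ∃ f1 : Fin l ⊕ Bool → ℕ,
      IsKL21Labeling (HCyc l) 6 f1 ∧
      f1 (Sum.inr false) = f 0 ∧
      f1 (Sum.inl ⟨0, by omega⟩) = f 1 ∧
      f1 (Sum.inl ⟨1, by omega⟩) = f 2 ∧
      f1 (Sum.inr true) = f 3 ∧
      PathExtendable (l - 2)
        (fun m : Fin (l - 2 + 2) => f1 (Sum.inl ⟨((m : ℕ) + 1) % l, Nat.mod_lt _ (by omega)⟩)) := by
  obtain ⟨g, ⟨hgL, hg6⟩, e0, e1, e2, e3, x, y, ex, ey, hx, hy, hxy⟩ := hg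
  obtain ⟨hC, hE⟩ := core_and_ends_of_labeling hl hgL e0 e1 e2 e3 ex ey (by omega)
  have k0 : f 0 ≤ 6 := e0 ▸ hg6 _
  have k1 : f 1 ≤ 6 := e1 ▸ hg6 _
  have k2 : f 2 ≤ 6 := e2 ▸ hg6 _
  have k3 : f 3 ≤ 6 := e3 ▸ hg6 _
  obtain ⟨s, hs, hfit⟩ := exists_fits (l - 2) (by omega) k0 k1 k2 k3 hC hx hy
    (by rwa [show l - 2 + 2 = l by omega]) hE
  exact hfit.exists_labeling hl k0 k1 k2 k3 hC hs
end
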